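/- Fix an integer n ≥ 7 and set a₁ = (n−6)/2, a₂ = (n−2)/2, a₃ = (n+2)/2. For every six-times differentiable function v : ℝ → ℝ and every t ∈ ℝ, one has −v⁽⁶⁾(t) + K₄·v⁽⁴⁾(t) − K₂·v″(t) + K₀·v(t) = (L_{a₁} ∘ L_{a₂} ∘ L_{a₃}) v (t), where L_a w := −w″ + a²·w. In other words, the sixth-order radial cylindrical operator factors as the composition of the three second-order operators L_{a₁}, L_{a₂}, L_{a₃}. -/

import Mathlib

noncomputable section

/-- K₄ = (3n² − 12n + 44)/4 -/
def K4 (n : ℕ) : ℝ := (3*(n:ℝ)^2 - 12*(n:ℝ) + 44)/4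

/-- K₂ = (3n⁴ − 24n³ + 72n² − 96n + 304)/16 -/
def K2 (n : ℕ) : ℝ := (3*(n:ℝ)^4 - 24*(n:ℝ)^3 + 72*(n:ℝ)^2 - 96*(n:ℝ) + 304)/16

/-- K₀ = (n−6)²(n−2)²(n+2)²/64 -/
def K0 (n : ℕ) : ℝ := ((n:ℝ)-6)^2*((n:ℝ)-2)^2*((n:ℝ)+2)^2/64

/-- The second-order operator L_a w = −w″ + a²·w. -/
def Lop (a : ℝ) (w : ℝ → ℝ) : ℝ → ℝ := fun t => -(iteratedDeriv 2 w t) + a^2 * w t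

theorem contDiff_iter_two {m : ℕ} {w : ℝ → ℝ} (hw : ContDiff ℝ ((m + 2 : ℕ) : WithTop ℕ∞) w) :
    ContDiff ℝ (m : WithTop ℕ∞) (iteratedDeriv 2 w) := by
  rw [iteratedDeriv_eq_iterate]
  exact ContDiff.iterate_deriv' m 2 (by exact_mod_cast hw)

theorem contDiff_Lop {m : ℕ} (a : ℝ) {w : ℝ → ℝ}
    (hw : ContDiff ℝ ((m + 2 : ℕ) : WithTop ℕ∞) w) :
    ContDiff ℝ (m : WithTop ℕ∞) (Lop a w) := by
  unfold Lop
  have h : ContDiff ℝ (m : WithTop ℕ∞) w := hw.of_le (by exact_mod_cast Nat.le_add_right m 2)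
  exact (contDiff_iter_two hw).neg.add (contDiff_const.mul h)

theorem iter_two_Lop (a : ℝ) {w : ℝ → ℝ} (hw : ContDiff ℝ ((4 : ℕ) : WithTop ℕ∞) w) :
    iteratedDeriv 2 (Lop a w) = Lop a (iteratedDeriv 2 w) := by
  have h2 : ContDiff ℝ ((2 : ℕ) : WithTop ℕ∞) w := hw.of_le (by norm_num)
  have hd : ContDiff ℝ ((2 : ℕ) : WithTop ℕ∞) (iteratedDeriv 2 w) := contDiff_iter_two (m := 2) hw
  funext t
  unfold Lop
  rw [iteratedDeriv_fun_add hd.neg.contDiffAt (contDiff_const.mul h2).contDiffAt,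
    iteratedDeriv_fun_neg, iteratedDeriv_const_mul_field]

theorem iter_two_iter (k : ℕ) (w : ℝ → ℝ) :
    iteratedDeriv 2 (iteratedDeriv k w) = iteratedDeriv (k + 2) w := by
  simp only [iteratedDeriv_eq_iterate]
  rw [add_comm, Function.iterate_add_apply]

/-- Factorization of the sixth-order radial cylindrical operator as
L_{(n−6)/2} ∘ L_{(n−2)/2} ∘ L_{(n+2)/2}. -/
theorem radial_operator_factorization (n : ℕ) (hn : 7 ≤ n) (v : ℝ → ℝ)
    (hv : ContDiff ℝ 6 v) (t : ℝ) :
    -(iteratedDeriv 6 v t) + K4 n * iteratedDeriv 4 v t - K2 n * iteratedDeriv 2 v t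
      + K0 n * v t
      = Lop (((n:ℝ)-6)/2) (Lop (((n:ℝ)-2)/2) (Lop (((n:ℝ)+2)/2) v)) t := by
  have h6 : ContDiff ℝ ((4 + 2 : ℕ) : WithTop ℕ∞) v := by exact_mod_cast hv
  have h4 : ContDiff ℝ ((4 : ℕ) : WithTop ℕ∞) v := h6.of_le (by norm_num)
  have e1 := iter_two_Lop (((n:ℝ)-2)/2) (contDiff_Lop (m := 4) (((n:ℝ)+2)/2) h6)
  have e2 := iter_two_Lop (((n:ℝ)+2)/2) h4
  have e3 := iter_two_Lop (((n:ℝ)+2)/2) (contDiff_iter_two (m := 4) h6)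
  have l (a : ℝ) (w : ℝ → ℝ) : Lop a w t = -(iteratedDeriv 2 w t) + a^2 * w t := rfl
  rw [l, e1, e2, l, e3, l, l]
  simp only [l, e2, iter_two_iter, K4, K2, K0]
  norm_num only [Nat.reduceAdd]
  ring
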